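/- For any non-decreasing function f : ℕ → ℝ with f(n) → +∞ as n → ∞, there exists a Sturmian word u such that PL_u(n) = o(f(n)), i.e., limsup_{n→∞} PL_u(n)/f(n) = 0. -/

import Mathlib

/-- The morphism ψ_b on letters: ψ_b(0) = 1·0^{b-1}, ψ_b(1) = 1·0^b
    (letters: `false` = 0, `true` = 1). -/
def psiL (b : ℕ) : Bool → List Bool
  | false => true :: List.replicate (b - 1) false
  | true  => true :: List.replicate b false

/-- The morphism ψ_b extended to words. -/
def psiW (b : ℕ) (v : List Bool) : List Bool := v.flatMap (psiL b)

/-- A palindrome is a word equal to its reversal. -/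
def IsPal {A : Type*} (w : List A) : Prop := w.reverse = w

/-- Palindromic length: minimal number of palindromes concatenating to `w`. -/
noncomputable def palLen {A : Type*} (w : List A) : ℕ :=
  sInf {k | ∃ l : List (List A), l.length = k ∧ (∀ p ∈ l, IsPal p) ∧ l.flatten = w}

/-- `v` is a factor of the infinite word `u`. -/
def FactorOf {A : Type*} (v : List A) (u : ℕ → A) : Prop :=
  ∃ i, v = (List.range v.length).map (fun k => u (i + k))

/-- A Sturmian word: exactly `n+1` factors of each length `n`. -/
def Sturmian (u : ℕ → Bool) : Prop :=
  ∀ n, Set.ncard {v : List Bool | v.length = n ∧ FactorOf v u} = n + 1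

/-- `u` has slope `α`: the frequency of the letter 1 (= `true`) is `α`. -/
def HasSlope (u : ℕ → Bool) (α : ℝ) : Prop :=
  Filter.Tendsto (fun n => (((List.range n).map u).count true : ℝ) / n)
    Filter.atTop (nhds α)

/-- The image of an infinite word under ψ_b. -/
noncomputable def psiInf (b : ℕ) (u : ℕ → Bool) : ℕ → Bool :=
  fun k => (((List.range (k + 1)).map u).flatMap (psiL b)).getD k false

/-- PL_u(n): maximal palindromic length of factors of length `n` of `u`. -/
noncomputable def PL (u : ℕ → Bool) (n : ℕ) : ℕ :=
  sSup {k | ∃ v : List Bool, v.length = n ∧ FactorOf v u ∧ palLen v = k}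

section PalindromicLength

variable {A : Type*}

theorem palLen_le_of_flatten (l : List (List A)) (h : ∀ p ∈ l, IsPal p) :
    palLen l.flatten ≤ l.length :=
  Nat.sInf_le ⟨l, rfl, h, rfl⟩

theorem isPal_singleton (a : A) : IsPal [a] := rfl

theorem exists_palindromic_factorization (w : List A) :
    ∃ l : List (List A), l.length = palLen w ∧ (∀ p ∈ l, IsPal p) ∧ l.flatten = w := by
  have hne : {k | ∃ l : List (List A), l.length = k ∧ (∀ p ∈ l, IsPal p) ∧
      l.flatten = w}.Nonempty := by
    refine ⟨_, w.map (fun a => [a]), rfl, ?_, ?_⟩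
    · intro p hp
      obtain ⟨a, -, rfl⟩ := List.mem_map.1 hp
      exact isPal_singleton a
    · induction w with
      | nil => rfl
      | cons a w ih => simp [ih]
  exact Nat.sInf_mem hne

theorem palLen_append_le (v w : List A) : palLen (v ++ w) ≤ palLen v + palLen w := by
  obtain ⟨l, hl, hp, rfl⟩ := exists_palindromic_factorization v
  obtain ⟨l', hl', hp', rfl⟩ := exists_palindromic_factorization w
  rw [← hl, ← hl', ← List.flatten_append, ← List.length_append]
  refine palLen_le_of_flatten _ fun p h => ?_
  rcases List.mem_append.1 h with h | h
  exacts [hp p h, hp' p h]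

theorem IsPal.palLen_le_one {w : List A} (h : IsPal w) : palLen w ≤ 1 := by
  simpa using palLen_le_of_flatten [w] (by simpa using h)

theorem palLen_nil : palLen ([] : List A) = 0 :=
  Nat.le_zero.1 (palLen_le_of_flatten [] (by simp))

end PalindromicLength

section Windows

variable {A : Type*}

/-- The factor of length `n` of `u` starting at position `i`. -/
def window (u : ℕ → A) (i n : ℕ) : List A := (List.range n).map (fun k => u (i + k))

@[simp] theorem length_window (u : ℕ → A) (i n : ℕ) : (window u i n).length = n := by
  simp [window]

theorem window_add (u : ℕ → A) (i a b : ℕ) :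
    window u i (a + b) = window u i a ++ window u (i + a) b := by
  simp [window, List.range_add, Function.comp_def, add_assoc]

theorem window_one (u : ℕ → A) (i : ℕ) : window u i 1 = [u i] := by
  simp [window]

theorem window_zero (u : ℕ → A) (i : ℕ) : window u i 0 = [] := rfl

theorem window_congr_iff {u : ℕ → A} {i i' n : ℕ} :
    window u i n = window u i' n ↔ ∀ k < n, u (i + k) = u (i' + k) := by
  simp [window]

theorem isPal_window {u : ℕ → A} {i n : ℕ} (h : ∀ k < n, u (i + (n - 1 - k)) = u (i + k)) :
    IsPal (window u i n) := by
  refine List.ext_getElem (by simp) fun k h1 h2 => ?_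
  have hk : k < n := by simpa using h2
  simpa [window] using h k hk

theorem palLen_window_add_le (u : ℕ → A) (i a b : ℕ) :
    palLen (window u i (a + b)) ≤ palLen (window u i a) + palLen (window u (i + a) b) := by
  rw [window_add]
  exact palLen_append_le _ _

theorem palLen_window_one_le (u : ℕ → A) (i : ℕ) : palLen (window u i 1) ≤ 1 := by
  rw [window_one]
  exact (isPal_singleton _).palLen_le_one

theorem palLen_window_le_mul {u : ℕ → A} {L B : ℕ}
    (h : ∀ i n, n ≤ L → palLen (window u i n) ≤ B) (c : ℕ) :
    ∀ i n, n ≤ c * L → palLen (window u i n) ≤ c * B := by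
  induction c with
  | zero =>
    intro i n hn
    obtain rfl : n = 0 := by simpa using hn
    simp [window_zero, palLen_nil]
  | succ c ih =>
    intro i n hn
    rw [Nat.succ_mul] at hn ⊢
    have hsplit : n = (n - min n L) + min n L := by omega
    rw [hsplit]
    refine (palLen_window_add_le _ _ _ _).trans (add_le_add (ih _ _ ?_) (h _ _ (min_le_right _ _)))
    omega

theorem palLen_window_le (u : ℕ → A) (i n : ℕ) : palLen (window u i n) ≤ n := by
  have h : ∀ i n, n ≤ 1 → palLen (window u i n) ≤ 1 := by
    intro i n hn
    interval_cases n
    · simp [window_zero, palLen_nil]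
    · exact palLen_window_one_le u i
  simpa using palLen_window_le_mul h n i n (by simp)

theorem factorOf_iff_window {v : List A} {u : ℕ → A} {n : ℕ} :
    v.length = n ∧ FactorOf v u ↔ ∃ i, window u i n = v := by
  constructor
  · rintro ⟨rfl, i, h⟩
    exact ⟨i, h.symm⟩
  · rintro ⟨i, rfl⟩
    exact ⟨length_window u i n, i, by rw [length_window]; rfl⟩

end Windows

theorem PL_le {u : ℕ → Bool} {n B : ℕ} (h : ∀ i, palLen (window u i n) ≤ B) : PL u n ≤ B := by
  refine csSup_le' ?_
  rintro k ⟨v, hv, hf, rfl⟩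
  obtain ⟨i, rfl⟩ := factorOf_iff_window.1 ⟨hv, hf⟩
  exact h i

section RationalRotation

/-- The periodic word of rational slope `p / q` and intercept `r / q`. -/
def rationalWord (p q r j : ℤ) : Bool := decide (((j + 1) * p + r) / q ≠ (j * p + r) / q)

theorem Int.neg_ediv_eq_neg_ediv {q : ℤ} (hq : 0 < q) (a : ℤ) :
    (-a) / q = -((a + q - 1) / q) := by
  have h1 := Int.emod_add_mul_ediv (a + q - 1) q
  have h2 := Int.emod_nonneg (a + q - 1) hq.ne'
  have h3 := Int.emod_lt_of_pos (a + q - 1) hq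
  refine (Int.ediv_emod_unique hq (r := q - 1 - (a + q - 1) % q)).2 ⟨?_, by omega, by omega⟩ |>.1
  linarith

/-- A periodic word of rational slope is symmetric about suitable centres. -/
theorem rationalWord_symm {p q r s : ℤ} (hq : 0 < q) (h : q ∣ s * p + 2 * r + 1) (j : ℤ) :
    rationalWord p q r (s - 1 - j) = rationalWord p q r j := by
  obtain ⟨c, hc⟩ := h
  have key : ∀ j : ℤ, ((s - j) * p + r) / q = c - 1 - (j * p + r) / q := by
    intro j
    have e1 : (s - j) * p + r = -(j * p + r + 1) + c * q := by linarith
    rw [e1, Int.add_mul_ediv_right _ _ hq.ne', Int.neg_ediv_eq_neg_ediv hq]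
    have e2 : j * p + r + 1 + q - 1 = j * p + r + 1 * q := by ring
    rw [e2, Int.add_mul_ediv_right _ _ hq.ne']
    ring
  have k1 := key j
  have k2 := key (j + 1)
  unfold rationalWord
  rw [show s - 1 - j + 1 = s - j by ring, show s - 1 - j = s - (j + 1) by ring, k1, k2]
  congr 1
  apply propext
  constructor <;> intro h1 h2 <;> apply h1 <;> omega

theorem palLen_window_rational_le {u : ℕ → Bool} {p q : ℕ} (hq : 0 < q) (hpq : Nat.Coprime p q)
    {M : ℕ} (hM : ∀ i n, n < q → palLen (window u i n) ≤ M) (r : ℤ) (i n : ℕ)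
    (hu : ∀ k < n, u (i + k) = rationalWord p q r ((i + k : ℕ) : ℤ)) :
    palLen (window u i n) ≤ 1 + M := by
  rcases lt_or_ge n q with h | h
  · exact (hM i n h).trans (by omega)
  have hq' : (0 : ℤ) < q := by exact_mod_cast hq
  obtain ⟨S, hS⟩ : ∃ S : ℤ, (q : ℤ) ∣ S * p + 2 * r + 1 := by
    have hc : IsCoprime (p : ℤ) (q : ℤ) := Nat.isCoprime_iff_coprime.2 hpq
    obtain ⟨a, b, hab⟩ := hc
    refine ⟨-(2 * r + 1) * a, (2 * r + 1) * b, ?_⟩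
    linear_combination (-(2 * r + 1)) * hab
  set d : ℤ := ((n : ℤ) - (S - 2 * i)) % q with hd
  have hd0 : 0 ≤ d := Int.emod_nonneg _ hq'.ne'
  have hd1 : d < q := Int.emod_lt_of_pos _ hq'
  have hd2 := Int.emod_add_mul_ediv ((n : ℤ) - (S - 2 * i)) q
  rw [← hd] at hd2
  obtain ⟨e, he⟩ : ∃ e : ℕ, d = e := ⟨d.toNat, by omega⟩
  obtain ⟨s, hs⟩ : ∃ s : ℕ, n = s + e := ⟨n - e, by omega⟩
  subst hs
  refine (palLen_window_add_le _ _ _ _).trans (add_le_add ?_ (hM _ _ (by omega)))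
  refine (isPal_window fun k hk => ?_).palLen_le_one
  rw [hu _ (by omega), hu _ (by omega)]
  have hdiv : (q : ℤ) ∣ (2 * i + s) * p + 2 * r + 1 := by
    obtain ⟨c, hc⟩ := hS
    refine ⟨c + (((s + e : ℕ) : ℤ) - (S - 2 * i)) / q * p, ?_⟩
    push_cast at hd2 ⊢
    linear_combination hc + (-(p : ℤ)) * hd2 + (p : ℤ) * he
  rw [← rationalWord_symm hq' hdiv]
  congr 1
  omega

end RationalRotation

section Mechanical

/-- The mechanical word of slope `α` and intercept `0`. -/
noncomputable def mechanicalWord (α : ℝ) (k : ℕ) : Bool :=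
  decide (⌊((k + 1 : ℕ) : ℝ) * α⌋ ≠ ⌊(k : ℝ) * α⌋)

theorem exists_switch {s : ℕ → ℤ} (hs : Monotone s) (i n : ℕ) (h : s (i + n) ≤ s i + 1) :
    ∃ t ≤ n, (∀ k ≤ t, s (i + k) = s i) ∧ ∀ k, t < k → k ≤ n → s (i + k) = s i + 1 := by
  induction n with
  | zero => exact ⟨0, le_rfl, by simp, by omega⟩
  | succ n ih =>
    have hle : s (i + n) ≤ s (i + (n + 1)) := hs (by omega)
    have hle' : s i ≤ s (i + n) := hs (by omega)
    obtain ⟨t, htn, h1, h2⟩ := ih (by omega)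
    by_cases hcase : s (i + (n + 1)) = s i
    · refine ⟨n + 1, le_rfl, fun k hk => ?_, by omega⟩
      have a1 : s i ≤ s (i + k) := hs (by omega)
      have a2 : s (i + k) ≤ s (i + (n + 1)) := hs (by omega)
      omega
    · refine ⟨t, by omega, h1, fun k hk hk' => ?_⟩
      rcases Nat.lt_or_ge n k with h3 | h3
      · obtain rfl : k = n + 1 := by omega
        omega
      · exact h2 k hk h3

theorem floor_mul_eq_ediv {α : ℝ} {p q : ℕ} (hq : 0 < q) (j : ℕ) :
    ⌊(j : ℝ) * α⌋ = ((j : ℤ) * p + ⌊(j : ℝ) * (α * q - p)⌋) / (q : ℤ) := by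
  have hq' : (q : ℝ) ≠ 0 := by positivity
  have e : (j : ℝ) * α = (((j * p : ℕ) : ℤ) + (j : ℝ) * (α * q - p)) / (q : ℝ) := by
    push_cast
    field_simp
    ring
  conv_lhs => rw [e]
  rw [Int.floor_div_natCast, Int.floor_intCast_add]
  push_cast
  rfl

/-- On windows short enough, a mechanical word is, up to one letter, made of two periodic words
of rational slope. -/
theorem palLen_window_mechanicalWord_le {α : ℝ} {p q : ℕ} (hq : 0 < q) (hpq : Nat.Coprime p q)
    (hpos : 0 ≤ α * q - p) {M : ℕ}
    (hM : ∀ i n, n < q → palLen (window (mechanicalWord α) i n) ≤ M) (i n : ℕ)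
    (hn : n * (α * q - p) ≤ 1) :
    palLen (window (mechanicalWord α) i n) ≤ 3 + 2 * M := by
  set s : ℕ → ℤ := fun j => ⌊(j : ℝ) * (α * q - p)⌋ with hsdef
  have hmono : Monotone s := fun a b hab => by
    refine Int.floor_le_floor ?_
    gcongr
  have hlast : s (i + n) ≤ s i + 1 := by
    have : ((i + n : ℕ) : ℝ) * (α * q - p) ≤ (i : ℝ) * (α * q - p) + (1 : ℤ) := by
      push_cast
      linarith
    simpa [hsdef] using (Int.floor_le_floor this).trans_eq (Int.floor_add_intCast _ _)
  obtain ⟨t, htn, h1, h2⟩ := exists_switch hmono i n hlast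
  have hrat : ∀ (j : ℕ) (r : ℤ), s j = r → s (j + 1) = r →
      mechanicalWord α j = rationalWord p q r (j : ℤ) := by
    intro j r hj hj'
    simp only [hsdef] at hj hj'
    unfold mechanicalWord rationalWord
    rw [floor_mul_eq_ediv hq (p := p) j, floor_mul_eq_ediv hq (p := p) (j + 1), hj, hj']
    push_cast
    rfl
  have hleft : palLen (window (mechanicalWord α) i t) ≤ 1 + M := by
    refine palLen_window_rational_le hq hpq hM (s i) i t fun k hk => ?_
    exact hrat _ _ (h1 k hk.le) (h1 (k + 1) hk)
  rcases htn.eq_or_lt with rfl | hlt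
  · omega
  obtain ⟨b, rfl⟩ : ∃ b, n = t + (1 + b) := ⟨n - t - 1, by omega⟩
  have hright : palLen (window (mechanicalWord α) (i + t + 1) b) ≤ 1 + M := by
    refine palLen_window_rational_le hq hpq hM (s i + 1) _ b fun k hk => ?_
    refine hrat _ _ ?_ ?_
    · rw [show i + t + 1 + k = i + (t + 1 + k) by ring]
      exact h2 _ (by omega) (by omega)
    · rw [show i + t + 1 + k + 1 = i + (t + 1 + k + 1) by ring]
      exact h2 _ (by omega) (by omega)
  have a1 := palLen_window_add_le (mechanicalWord α) i t (1 + b)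
  have a2 := palLen_window_add_le (mechanicalWord α) (i + t) 1 b
  have a3 := palLen_window_one_le (mechanicalWord α) (i + t)
  omega

end Mechanical

section Complexity

theorem exists_interval_card_filter_le (S : Finset ℝ) :
    ∀ B : ℝ, 0 < B → (∀ t ∈ S, 0 < t ∧ t < B) → ∀ c ≤ S.card,
      ∃ a b : ℝ, 0 ≤ a ∧ a < b ∧ b ≤ B ∧
        ∀ x, a < x → x < b → (S.filter (· ≤ x)).card = c := by
  induction S using Finset.induction_on_max with
  | empty =>
    intro B hB _ c hc
    exact ⟨0, B, le_rfl, hB, le_rfl, fun x _ _ => by simpa [eq_comm] using hc⟩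
  | insert m S hm ih =>
    intro B hB hS c hc
    have hmS : m ∉ S := fun h => lt_irrefl _ (hm m h)
    obtain ⟨hm0, hmB⟩ := hS m (Finset.mem_insert_self _ _)
    rw [Finset.card_insert_of_notMem hmS] at hc
    rcases Nat.lt_or_ge S.card c with h | h
    · refine ⟨m, B, hm0.le, hmB, le_rfl, fun x hx _ => ?_⟩
      rw [Finset.filter_true_of_mem, Finset.card_insert_of_notMem hmS]
      · omega
      · intro t ht
        rcases Finset.mem_insert.1 ht with rfl | ht
        exacts [hx.le, (hm t ht).le.trans hx.le]
    · obtain ⟨a, b, ha, hab, hb, hx⟩ := ih m hm0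
        (fun t ht => ⟨(hS t (Finset.mem_insert_of_mem ht)).1, hm t ht⟩) c h
      refine ⟨a, b, ha, hab, hb.trans hmB.le, fun x hax hxb => ?_⟩
      rw [Finset.filter_insert, if_neg (by linarith)]
      exact hx x hax hxb

theorem exists_fract_mul_mem_Ioo {α : ℝ}
    (happrox : ∀ δ > 0, ∃ p q : ℕ, 0 < α * q - p ∧ α * q - p < δ)
    {a b : ℝ} (ha : 0 ≤ a) (hab : a < b) (hb : b ≤ 1) :
    ∃ i : ℕ, a < Int.fract ((i : ℝ) * α) ∧ Int.fract ((i : ℝ) * α) < b := by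
  obtain ⟨p, q, h0, h1⟩ := happrox (b - a) (by linarith)
  set η := α * q - p with hη
  set c := ⌊a / η⌋₊ + 1 with hc
  have h2 : a < c * η := by
    have := Nat.lt_floor_add_one (a / η)
    rw [div_lt_iff₀ h0] at this
    rw [hc]
    push_cast
    exact this
  have h3 : c * η < b := by
    have := Nat.floor_le (div_nonneg ha h0.le)
    rw [le_div_iff₀ h0] at this
    rw [hc]
    push_cast
    linarith
  have h4 : Int.fract (((c * q : ℕ) : ℝ) * α) = c * η := by
    have e : ((c * q : ℕ) : ℝ) * α = ((c * p : ℕ) : ℝ) + c * η := by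
      rw [hη]
      push_cast
      ring
    rw [e, Int.fract_natCast_add, Int.fract_eq_self]
    constructor <;> linarith
  exact ⟨c * q, by rw [h4]; exact h2, by rw [h4]; exact h3⟩

theorem irrational_of_approx {α : ℝ}
    (happrox : ∀ δ > 0, ∃ p q : ℕ, 0 < α * q - p ∧ α * q - p < δ) : Irrational α := by
  rintro ⟨x, rfl⟩
  have hd : (0 : ℝ) < x.den := by exact_mod_cast x.den_pos
  obtain ⟨p, q, h0, h1⟩ := happrox (1 / x.den) (by positivity)
  have e : ((x : ℝ) * q - p) * x.den = ((x.num * q - p * x.den : ℤ) : ℝ) := by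
    have hx : (x : ℝ) * x.den = x.num := by exact_mod_cast x.mul_den_eq_num
    push_cast
    linear_combination (q : ℝ) * hx
  rw [lt_div_iff₀ hd, e] at h1
  have h2 := mul_pos h0 hd
  rw [e] at h2
  have h3 : x.num * q - p * x.den < 1 := by exact_mod_cast h1
  have h4 : 0 < x.num * q - p * x.den := by exact_mod_cast h2
  omega

theorem floor_add_mul (α : ℝ) (i j : ℕ) :
    ⌊((i + j : ℕ) : ℝ) * α⌋ = ⌊(i : ℝ) * α⌋ + ⌊(j : ℝ) * α⌋ +
      if 1 - Int.fract ((j : ℝ) * α) ≤ Int.fract ((i : ℝ) * α) then 1 else 0 := by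
  have h1 := Int.floor_add_fract ((i : ℝ) * α)
  have h2 := Int.floor_add_fract ((j : ℝ) * α)
  have a1 := Int.fract_nonneg ((i : ℝ) * α)
  have a2 := Int.fract_nonneg ((j : ℝ) * α)
  have b1 := Int.fract_lt_one ((i : ℝ) * α)
  have b2 := Int.fract_lt_one ((j : ℝ) * α)
  rw [Int.floor_eq_iff]
  split_ifs with h <;> push_cast <;> constructor <;> linarith

theorem mechanicalWord_window_eq_iff {α : ℝ} (h0 : 0 ≤ α) (h1 : α < 1) (i i' n : ℕ) :
    window (mechanicalWord α) i n = window (mechanicalWord α) i' n ↔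
      ∀ j ≤ n, (1 - Int.fract ((j : ℝ) * α) ≤ Int.fract ((i : ℝ) * α) ↔
        1 - Int.fract ((j : ℝ) * α) ≤ Int.fract ((i' : ℝ) * α)) := by
  have step : ∀ k : ℕ, ⌊((k + 1 : ℕ) : ℝ) * α⌋ =
      ⌊(k : ℝ) * α⌋ + if mechanicalWord α k then 1 else 0 := by
    intro k
    have l1 : ⌊(k : ℝ) * α⌋ ≤ ⌊((k + 1 : ℕ) : ℝ) * α⌋ := by
      refine Int.floor_le_floor ?_
      gcongr
      omega
    have l2 : ⌊((k + 1 : ℕ) : ℝ) * α⌋ ≤ ⌊(k : ℝ) * α⌋ + 1 := by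
      rw [← Int.floor_add_one]
      refine Int.floor_le_floor ?_
      push_cast
      linarith
    by_cases hk : ⌊((k + 1 : ℕ) : ℝ) * α⌋ = ⌊(k : ℝ) * α⌋
    · have : mechanicalWord α k = false := decide_eq_false (not_not.2 hk)
      simp only [this, hk, Bool.false_eq_true, if_false, add_zero]
    · have : mechanicalWord α k = true := by simpa [mechanicalWord] using hk
      rw [this, if_pos rfl]
      omega
  have hfloor : (∀ k < n, mechanicalWord α (i + k) = mechanicalWord α (i' + k)) ↔
      ∀ j ≤ n, ⌊((i + j : ℕ) : ℝ) * α⌋ - ⌊(i : ℝ) * α⌋ =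
        ⌊((i' + j : ℕ) : ℝ) * α⌋ - ⌊(i' : ℝ) * α⌋ := by
    constructor
    · intro h j
      induction j with
      | zero => simp
      | succ j ih =>
        intro hj
        have e1 := step (i + j)
        have e2 := step (i' + j)
        rw [h j hj] at e1
        have := ih (by omega)
        rw [← add_assoc, ← add_assoc]
        omega
    · intro h k hk
      have e1 := step (i + k)
      have e2 := step (i' + k)
      have g1 := h k hk.le
      have g2 := h (k + 1) hk
      rw [← add_assoc, ← add_assoc] at g2
      rw [Bool.eq_iff_iff]
      split_ifs at e1 e2 with c1 c2 c2
      · exact iff_of_true c1 c2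
      · omega
      · omega
      · exact iff_of_false c1 c2
  rw [window_congr_iff, hfloor]
  refine forall₂_congr fun j _ => ?_
  rw [floor_add_mul α i j, floor_add_mul α i' j]
  split_ifs with c1 c2 c2 <;> simp [c1, c2] <;> omega

theorem sturmian_mechanicalWord {α : ℝ} (h0 : 0 ≤ α) (h1 : α < 1)
    (happrox : ∀ δ > 0, ∃ p q : ℕ, 0 < α * q - p ∧ α * q - p < δ) :
    Sturmian (mechanicalWord α) := by
  intro n
  have hirr := irrational_of_approx happrox
  set τ : ℕ → ℝ := fun j => 1 - Int.fract ((j : ℝ) * α) with hτ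
  have hinj : Function.Injective τ := by
    intro j j' h
    have hf : Int.fract ((j : ℝ) * α) = Int.fract ((j' : ℝ) * α) := by
      simp only [hτ] at h
      linarith
    obtain ⟨z, hz⟩ := Int.fract_eq_fract.1 hf
    by_contra hne
    have hne' : ((j : ℤ) - j') ≠ 0 := by omega
    refine (hirr.intCast_mul hne').ne_int z ?_
    push_cast
    linarith
  have hmem : ∀ j : ℕ, j ≠ 0 → 0 < τ j ∧ τ j < 1 := by
    intro j hj
    have hlt := Int.fract_lt_one ((j : ℝ) * α)
    have hnn := Int.fract_nonneg ((j : ℝ) * α)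
    have hz : τ j ≠ τ 0 := fun h => hj (hinj h)
    have hz' : Int.fract ((j : ℝ) * α) ≠ 0 := by simpa [hτ] using hz
    have := lt_of_le_of_ne hnn hz'.symm
    constructor <;> simp only [hτ] <;> linarith
  set S : Finset ℝ := (Finset.Icc 1 n).image τ with hS
  have hcard : S.card = n := by
    rw [hS, Finset.card_image_of_injective _ hinj]
    simp
  set cnt : ℕ → ℕ := fun i => (S.filter (· ≤ Int.fract ((i : ℝ) * α))).card with hcnt
  have hsurj : ∀ c : ℕ, ∃ i, c ≤ n → cnt i = c := by
    intro c
    by_cases hc : c ≤ n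
    · obtain ⟨a, b, ha, hab, hb, hx⟩ := exists_interval_card_filter_le S 1 one_pos
        (by
          intro t ht
          obtain ⟨j, hj, rfl⟩ := Finset.mem_image.1 ht
          have := (Finset.mem_Icc.1 hj).1
          exact hmem j (by omega)) c (hcard ▸ hc)
      obtain ⟨i, hi1, hi2⟩ := exists_fract_mul_mem_Ioo happrox ha hab hb
      exact ⟨i, fun _ => hx _ hi1 hi2⟩
    · exact ⟨0, fun h => absurd h hc⟩
  choose g hg using hsurj
  have hfilter : ∀ i i' : ℕ, S.filter (· ≤ Int.fract ((i : ℝ) * α)) =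
      S.filter (· ≤ Int.fract ((i' : ℝ) * α)) ↔ cnt i = cnt i' := by
    intro i i'
    refine ⟨fun h => congrArg Finset.card h, fun h => ?_⟩
    rcases le_total (Int.fract ((i : ℝ) * α)) (Int.fract ((i' : ℝ) * α)) with hle | hle
    · exact Finset.eq_of_subset_of_card_le
        (Finset.monotone_filter_right _ fun x _ hx => le_trans hx hle) h.ge
    · exact (Finset.eq_of_subset_of_card_le
        (Finset.monotone_filter_right _ fun x _ hx => le_trans hx hle) h.le).symm
  have hwin : ∀ i i', window (mechanicalWord α) i n = window (mechanicalWord α) i' n ↔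
      cnt i = cnt i' := by
    intro i i'
    rw [← hfilter, mechanicalWord_window_eq_iff h0 h1, Finset.filter_inj']
    constructor
    · intro h t ht
      obtain ⟨j, hj, rfl⟩ := Finset.mem_image.1 ht
      exact h j (Finset.mem_Icc.1 hj).2
    · intro h j hj
      rcases Nat.eq_zero_or_pos j with rfl | hj0
      · have a1 := Int.fract_lt_one ((i : ℝ) * α)
        have a2 := Int.fract_lt_one ((i' : ℝ) * α)
        simp [not_le.2 a1, not_le.2 a2]
      · exact h (Finset.mem_image_of_mem _ (Finset.mem_Icc.2 ⟨hj0, hj⟩))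
  have hle : ∀ i, cnt i ≤ n := fun i => hcard ▸ Finset.card_filter_le _ _
  have himage : {v : List Bool | v.length = n ∧ FactorOf v (mechanicalWord α)} =
      (fun c => window (mechanicalWord α) (g c) n) '' Set.Iic n := by
    ext v
    rw [Set.mem_ofPred_eq, factorOf_iff_window]
    constructor
    · rintro ⟨i, rfl⟩
      exact ⟨cnt i, hle i, (hwin _ _).2 (hg _ (hle i))⟩
    · rintro ⟨c, -, rfl⟩
      exact ⟨g c, rfl⟩
  rw [himage, Set.InjOn.ncard_image]
  · rw [← Finset.coe_Iic, Set.ncard_coe_finset]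
    simp
  · intro c hc c' hc' h
    have := (hwin _ _).1 h
    rwa [hg c hc, hg c' hc'] at this

end Complexity

section Slope

/-- A sum of sparse negative powers of two, with its dyadic approximations. -/
theorem exists_dyadic_slope {m : ℕ → ℕ} (hm : StrictMono m) (hm0 : 2 ≤ m 0) :
    ∃ α : ℝ, 0 ≤ α ∧ α < 1 ∧ ∀ k, ∃ p : ℕ, Odd p ∧ 0 < α * (2 ^ m k : ℕ) - p ∧
      α * (2 ^ m k : ℕ) - p ≤ 2 * 2 ^ m k / 2 ^ m (k + 1) := by
  have hbound : ∀ k i, (1 / 2 : ℝ) ^ m (i + k) ≤ (1 / 2) ^ m k * (1 / 2) ^ i := by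
    intro k i
    rw [← pow_add]
    refine pow_le_pow_of_le_one (by norm_num) (by norm_num) ?_
    rw [add_comm (m k) i]
    exact hm.add_le_nat i k
  have hsum : ∀ k, Summable fun i => (1 / 2 : ℝ) ^ m (i + k) := fun k =>
    Summable.of_nonneg_of_le (fun i => by positivity) (hbound k)
      (summable_geometric_two.mul_left _)
  have htail : ∀ k, ∑' i, (1 / 2 : ℝ) ^ m (i + k) ≤ 2 * (1 / 2) ^ m k := by
    intro k
    refine ((hsum k).tsum_le_tsum (hbound k) (summable_geometric_two.mul_left _)).trans ?_
    rw [tsum_mul_left, tsum_geometric_two, mul_comm]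
  have hpartial : ∀ k, ∃ p : ℕ, Odd p ∧
      (∑ i ∈ Finset.range (k + 1), (1 / 2 : ℝ) ^ m i) * 2 ^ m k = p := by
    intro k
    induction k with
    | zero => exact ⟨1, odd_one, by simp⟩
    | succ k ih =>
      obtain ⟨p, -, hp⟩ := ih
      have hlt : m k < m (k + 1) := hm (Nat.lt_succ_self k)
      obtain ⟨d, hd⟩ : ∃ d, m (k + 1) = m k + (d + 1) := ⟨m (k + 1) - m k - 1, by omega⟩
      refine ⟨p * 2 ^ (d + 1) + 1, ?_, ?_⟩
      · exact Even.add_one (((even_two).pow_of_ne_zero (by omega)).mul_left _)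
      · rw [Finset.sum_range_succ, add_mul, ← mul_pow]
        push_cast
        rw [← hp, hd, pow_add]
        norm_num
        ring
  refine ⟨∑' i, (1 / 2 : ℝ) ^ m i, tsum_nonneg fun i => by positivity, ?_, fun k => ?_⟩
  · have h := htail 0
    have h2 : (1 / 2 : ℝ) ^ m 0 ≤ (1 / 2) ^ 2 :=
      pow_le_pow_of_le_one (by norm_num) (by norm_num) hm0
    simp only [add_zero] at h
    norm_num at h h2 ⊢
    linarith
  · obtain ⟨p, hodd, hp⟩ := hpartial k
    have hsplit := (hsum 0).sum_add_tsum_nat_add (k + 1)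
    simp only [add_zero] at hsplit
    refine ⟨p, hodd, ?_⟩
    have e : (∑' i, (1 / 2 : ℝ) ^ m i) * (2 ^ m k : ℕ) - p =
        (∑' i, (1 / 2 : ℝ) ^ m (i + (k + 1))) * 2 ^ m k := by
      rw [← hsplit, ← hp]
      push_cast
      ring
    rw [e]
    constructor
    · exact mul_pos ((hsum (k + 1)).tsum_pos (fun i => by positivity) 0 (by positivity))
        (by positivity)
    · calc _ ≤ 2 * (1 / 2 : ℝ) ^ m (k + 1) * 2 ^ m k := by
            gcongr
            exact htail (k + 1)
        _ = _ := by
            rw [one_div, inv_pow]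
            ring

/-- Exponents growing fast enough with respect to `f`. -/
theorem exists_fast_exponents {f : ℕ → ℝ} (htop : Filter.Tendsto f Filter.atTop Filter.atTop)
    (G : ℕ → ℕ) :
    ∃ m : ℕ → ℕ, 2 ≤ m 0 ∧ ∀ k, ∃ d, m (k + 1) = m k + 1 + d ∧ k ≤ d ∧
      ∀ n, 2 ^ d ≤ n → ((k + 1) * G (m k) : ℝ) ≤ f n := by
  have hN : ∀ C : ℝ, ∃ N : ℕ, ∀ n ≥ N, C ≤ f n := fun C =>
    Filter.eventually_atTop.1 (htop.eventually_ge_atTop C)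
  choose N hN using hN
  let m : ℕ → ℕ := fun k => Nat.rec 2 (fun k a => a + 1 + (N ((k + 1) * G a) + k)) k
  refine ⟨m, le_rfl, fun k => ⟨N ((k + 1) * G (m k)) + k, rfl, by omega, fun n hn => ?_⟩⟩
  refine hN _ n (le_trans ?_ hn)
  have := Nat.lt_two_pow_self (n := N ((k + 1) * G (m k)) + k)
  omega

end Slope

/-- The bound holding on windows shorter than `q'' / (2 q')`, when `q`, `q'`, `q''` are successive
denominators. -/
theorem palLen_window_two_levels_le {α : ℝ} {p q p' q' L : ℕ} (hq : 0 < q) (hq' : 0 < q')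
    (hpq : Nat.Coprime p q) (hpq' : Nat.Coprime p' q')
    (hpos : 0 ≤ α * q - p) (hpos' : 0 ≤ α * q' - p')
    (hL : L * (α * q - p) ≤ 1) (hqL : q' ≤ 2 * q * L) (i n : ℕ)
    (hn : n * (α * q' - p') ≤ 1) :
    palLen (window (mechanicalWord α) i n) ≤ 3 + 2 * (2 * q * (3 + 2 * q)) := by
  refine palLen_window_mechanicalWord_le hq' hpq' hpos' (fun j l hl => ?_) i n hn
  refine palLen_window_le_mul (L := L) (fun j l hl => ?_) _ j l (hl.le.trans hqL)
  refine palLen_window_mechanicalWord_le hq hpq hpos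
    (fun j l hl => (palLen_window_le _ j l).trans hl.le) j l (le_trans ?_ hL)
  gcongr

theorem stmt11 (f : ℕ → ℝ) (hmono : Monotone f)
    (htop : Filter.Tendsto f Filter.atTop Filter.atTop) :
    ∃ u : ℕ → Bool, Sturmian u ∧
      Filter.limsup (fun n => (PL u n : ℝ) / f n) Filter.atTop = 0 := by
  obtain ⟨m, hm0, hm⟩ := exists_fast_exponents htop
    fun a => 3 + 2 * (2 * 2 ^ a * (3 + 2 * 2 ^ a))
  choose d hd hkd hf using hm
  have hmono_m : StrictMono m := strictMono_nat_of_lt_succ fun k => by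
    rw [hd k]
    omega
  obtain ⟨α, hα0, hα1, hα⟩ := exists_dyadic_slope hmono_m hm0
  choose p hodd hpos hle using hα
  have hshort : ∀ k, ((2 ^ d k : ℕ) : ℝ) * (α * (2 ^ m k : ℕ) - p k) ≤ 1 := by
    intro k
    calc ((2 ^ d k : ℕ) : ℝ) * (α * (2 ^ m k : ℕ) - p k)
        ≤ ((2 ^ d k : ℕ) : ℝ) * (2 * 2 ^ m k / 2 ^ m (k + 1)) := by
          gcongr
          exact hle k
      _ = 1 := by
          rw [hd k, pow_add, pow_add]
          push_cast
          field_simp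
  have hPL : ∀ k n, n ≤ 2 ^ d (k + 1) →
      PL (mechanicalWord α) n ≤ 3 + 2 * (2 * 2 ^ m k * (3 + 2 * 2 ^ m k)) := by
    intro k n hn
    refine PL_le fun i => palLen_window_two_levels_le (L := 2 ^ d k) (q' := 2 ^ m (k + 1))
      (by positivity) (by positivity) ((hodd k).coprime_two_right.pow_right _)
      ((hodd (k + 1)).coprime_two_right.pow_right _) (hpos k).le (hpos (k + 1)).le (hshort k)
      ?_ i n ?_
    · rw [hd k, pow_add, pow_add]
      exact le_of_eq (by ring)
    · refine le_trans ?_ (hshort (k + 1))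
      have := (hpos (k + 1)).le
      gcongr
  refine ⟨mechanicalWord α, sturmian_mechanicalWord hα0 hα1 fun δ hδ => ?_, ?_⟩
  · obtain ⟨k, hk⟩ := exists_pow_lt_of_lt_one hδ (by norm_num : (1 / 2 : ℝ) < 1)
    refine ⟨p k, 2 ^ m k, hpos k, lt_of_le_of_lt (le_trans (hle k) ?_) hk⟩
    rw [hd k, pow_add, pow_add]
    have : (1 / 2 : ℝ) ^ d k ≤ (1 / 2) ^ k :=
      pow_le_pow_of_le_one (by norm_num) (by norm_num) (hkd k)
    refine le_trans (le_of_eq ?_) this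
    rw [one_div, inv_pow]
    field_simp
  · refine Filter.Tendsto.limsup_eq ?_
    have hbound : ∀ K : ℕ, ∀ᶠ n in Filter.atTop,
        (PL (mechanicalWord α) n : ℝ) / f n ≤ 1 / (K + 1) := by
      intro K
      filter_upwards [Filter.eventually_ge_atTop (∑ j ∈ Finset.range (K + 1), 2 ^ d j)] with n hn
      have hex : ∃ k, n < 2 ^ d k :=
        ⟨n, lt_of_lt_of_le Nat.lt_two_pow_self (Nat.pow_le_pow_right two_pos (hkd n))⟩
      have hlarge : ∀ k ≤ K, 2 ^ d k ≤ n := fun k hk =>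
        (Finset.single_le_sum (f := fun j => 2 ^ d j) (fun _ _ => Nat.zero_le _)
          (Finset.mem_range.2 (Nat.lt_succ_of_le hk))).trans hn
      have hK : K < Nat.find hex := by
        by_contra h
        exact absurd (Nat.find_spec hex) (not_lt.2 (hlarge _ (not_lt.1 h)))
      obtain ⟨k, hk⟩ : ∃ k, Nat.find hex = k + 1 := ⟨Nat.find hex - 1, by omega⟩
      have hlt : n < 2 ^ d (k + 1) := hk ▸ Nat.find_spec hex
      have hge : 2 ^ d k ≤ n := not_lt.1 (Nat.find_min hex (by omega))
      have h1 : (PL (mechanicalWord α) n : ℝ) ≤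
          ((3 + 2 * (2 * 2 ^ m k * (3 + 2 * 2 ^ m k)) : ℕ) : ℝ) := by
        exact_mod_cast hPL k n hlt.le
      have h2 := hf k n hge
      have hGpos : (0 : ℝ) < ((3 + 2 * (2 * 2 ^ m k * (3 + 2 * 2 ^ m k)) : ℕ) : ℝ) := by
        positivity
      have hKk : (K : ℝ) ≤ k := by exact_mod_cast (by omega : K ≤ k)
      have hfpos : 0 < f n := lt_of_lt_of_le (by positivity) h2
      rw [div_le_div_iff₀ hfpos (by positivity), one_mul]
      calc _ ≤ ((3 + 2 * (2 * 2 ^ m k * (3 + 2 * 2 ^ m k)) : ℕ) : ℝ) * (k + 1) := by gcongr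
        _ ≤ f n := by rwa [mul_comm]
    refine tendsto_order.2 ⟨fun a ha => ?_, fun a ha => ?_⟩
    · filter_upwards [htop.eventually_ge_atTop 0] with n hn
      exact ha.trans_le (by positivity)
    · obtain ⟨K, hK⟩ := exists_nat_one_div_lt ha
      filter_upwards [hbound K] with n hn
      exact hn.trans_lt hK
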